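/- arXiv:2007.12077 — 9 statements merged into one kernel-verified Lean document; each statement's English description precedes it below -/
import Mathlib

section
/- Let G be a simple graph on n vertices that is c-closed (every pair of distinct non-adjacent vertices has fewer than c common neighbors), with c ≥ 1. Then the number of 3-element vertex subsets of G whose induced subgraph is isomorphic to the path P3 on three vertices is at most (c−1)·n·(n−1)/2. -/
/-- In a `c`-closed graph on `n` vertices (`c ≥ 1`), the number of 3-element vertex
subsets inducing a path `P₃` is at most `(c-1)·n·(n-1)/2`. -/
theorem stmt_0 {V : Type*} [Fintype V] [DecidableEq V] (G : SimpleGraph V) (c : ℕ)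
    (hc : 1 ≤ c)
    (hclosed : ∀ u v : V, u ≠ v → ¬G.Adj u v →
      (G.neighborSet u ∩ G.neighborSet v).ncard < c) :
    {s : Finset V | s.card = 3 ∧ ∃ x y z : V, s = {x, y, z} ∧ x ≠ y ∧ x ≠ z ∧ y ≠ z ∧
      G.Adj x y ∧ G.Adj y z ∧ ¬G.Adj x z}.ncard ≤
      (c - 1) * (Fintype.card V * (Fintype.card V - 1) / 2) := by
  classical
  let middles (p : Finset V) : Finset V :=
    {y | (∀ v ∈ p, G.Adj v y) ∧ ∀ u ∈ p, ∀ v ∈ p, ¬G.Adj u v}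
  let cover : Finset (Finset V) :=
    (Finset.powersetCard 2 Finset.univ).biUnion fun p => (middles p).image fun y => insert y p
  have card_middles_le : ∀ p ∈ Finset.powersetCard 2 (Finset.univ : Finset V),
      ((middles p).image fun y => insert y p).card ≤ c - 1 := by
    intro p hp
    obtain ⟨u, v, huv, rfl⟩ := Finset.card_eq_two.1 (Finset.mem_powersetCard.1 hp).2
    refine Finset.card_image_le.trans ?_
    by_cases hadj : G.Adj u v
    · have h_empty : middles {u, v} = ∅ := by
        ext y
        simp [middles, hadj]
      simp [h_empty]
    · have h_le : (middles {u, v}).card ≤ (G.neighborSet u ∩ G.neighborSet v).ncard := by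
        rw [← Set.ncard_coe_finset]
        refine Set.ncard_le_ncard (fun y hy => ?_) (Set.toFinite _)
        have h := (Finset.mem_filter.1 (Finset.mem_coe.1 hy)).2.1
        exact ⟨h u (by simp), h v (by simp)⟩
      have := hclosed u v huv hadj
      omega
  have subset_cover : {s : Finset V | s.card = 3 ∧ ∃ x y z : V, s = {x, y, z} ∧ x ≠ y ∧ x ≠ z ∧
      y ≠ z ∧ G.Adj x y ∧ G.Adj y z ∧ ¬G.Adj x z} ⊆ (cover : Set (Finset V)) := by
    rintro s ⟨-, x, y, z, rfl, -, hxz, -, hxy, hyz, hnadj⟩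
    refine Finset.mem_coe.2 (Finset.mem_biUnion.2 ⟨{x, z}, ?_, Finset.mem_image.2 ⟨y, ?_, ?_⟩⟩)
    · simp [Finset.mem_powersetCard, Finset.card_pair hxz]
    · simp [middles, hxy, hyz.symm, hnadj, G.adj_comm z x]
    · exact Finset.insert_comm y x {z}
  calc _ ≤ (cover : Set (Finset V)).ncard := Set.ncard_le_ncard subset_cover (Set.toFinite _)
    _ = cover.card := Set.ncard_coe_finset _
    _ ≤ (Finset.powersetCard 2 (Finset.univ : Finset V)).card * (c - 1) :=
      Finset.card_biUnion_le_card_mul _ _ _ card_middles_le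
    _ = (c - 1) * (Fintype.card V * (Fintype.card V - 1) / 2) := by
      rw [Finset.card_powersetCard, Finset.card_univ, Nat.choose_two_right, mul_comm]
end

section
/- Let G be a c-closed simple graph (c ≥ 1) and let C be a maximal clique of G with |C| ≥ 2c. Then either V(G) \ C is a clique, or G contains an induced co-diamond, i.e., a 4-element vertex subset inducing exactly one edge (an edge plus two isolated vertices). -/
/-- In a `c`-closed graph, a vertex outside a maximal clique `C` has fewer than `c` neighbors
in `C`. -/
theorem ncard_inter_neighborSet_lt_of_maximal_clique {V : Type*} [Finite V] (G : SimpleGraph V)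
    (c : ℕ) (hclosed : ∀ u v : V, u ≠ v → ¬G.Adj u v →
      (G.neighborSet u ∩ G.neighborSet v).ncard < c)
    (C : Set V) (hC : G.IsClique C) (hmax : ∀ v ∉ C, ¬G.IsClique (insert v C))
    (x : V) (hx : x ∉ C) : (C ∩ G.neighborSet x).ncard < c := by
  obtain ⟨w, hw, hxw⟩ : ∃ w ∈ C, ¬G.Adj x w := by
    by_contra! h
    exact hmax x hx (hC.insert fun w hw _ => h w hw)
  have hne : x ≠ w := fun h => hx (h ▸ hw)
  refine lt_of_le_of_lt (Set.ncard_le_ncard ?_ (Set.toFinite _)) (hclosed x w hne hxw)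
  rintro z ⟨hz, hxz⟩
  refine ⟨hxz, hC hw hz ?_⟩
  rintro rfl
  exact hxw hxz

/-- If `G` is `c`-closed (`c ≥ 1`) and `C` is a maximal clique with `|C| ≥ 2c`, then either
the complement of `C` is a clique, or `G` contains an induced co-diamond (four vertices
spanning exactly one edge). -/
theorem stmt_3 {V : Type*} [Fintype V] (G : SimpleGraph V) (c : ℕ) (hc : 1 ≤ c)
    (hclosed : ∀ u v : V, u ≠ v → ¬G.Adj u v →
      (G.neighborSet u ∩ G.neighborSet v).ncard < c)
    (C : Set V) (hC : G.IsClique C) (hmax : ∀ v ∉ C, ¬G.IsClique (insert v C))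
    (hcard : 2 * c ≤ C.ncard) :
    G.IsClique Cᶜ ∨
      ∃ a b x y : V, a ≠ b ∧ a ≠ x ∧ a ≠ y ∧ b ≠ x ∧ b ≠ y ∧ x ≠ y ∧
        G.Adj a b ∧ ¬G.Adj a x ∧ ¬G.Adj a y ∧ ¬G.Adj b x ∧ ¬G.Adj b y ∧ ¬G.Adj x y := by
  refine or_iff_not_imp_left.mpr fun hnot => ?_
  obtain ⟨x, hx, y, hy, hxy, hadj⟩ : ∃ x ∉ C, ∃ y ∉ C, x ≠ y ∧ ¬G.Adj x y := by
    by_contra! h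
    exact hnot fun x hx y hy hxy => h x hx y hy hxy
  have h1 := ncard_inter_neighborSet_lt_of_maximal_clique G c hclosed C hC hmax x hx
  have h2 := ncard_inter_neighborSet_lt_of_maximal_clique G c hclosed C hC hmax y hy
  have h3 := Set.ncard_union_le (C ∩ G.neighborSet x) (C ∩ G.neighborSet y)
  have h4 := Set.le_ncard_sdiff ((C ∩ G.neighborSet x) ∪ (C ∩ G.neighborSet y)) C
  obtain ⟨a, b, ⟨ha, ha'⟩, ⟨hb, hb'⟩, hab⟩ :=
    (Set.one_lt_ncard_iff (Set.toFinite _)).mp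
      (show 1 < (C \ ((C ∩ G.neighborSet x) ∪ (C ∩ G.neighborSet y))).ncard by omega)
  simp only [Set.mem_union, Set.mem_inter_iff, SimpleGraph.mem_neighborSet, ha, hb, true_and,
    not_or] at ha' hb'
  exact ⟨a, b, x, y, hab, fun h => hx (h ▸ ha), fun h => hy (h ▸ ha), fun h => hx (h ▸ hb),
    fun h => hy (h ▸ hb), hxy, hC ha hb hab, fun h => ha'.1 h.symm, fun h => ha'.2 h.symm,
    fun h => hb'.1 h.symm, fun h => hb'.2 h.symm, hadj⟩
end

section
/- Let G be a c-closed simple graph (c ≥ 1) whose vertex set cannot be partitioned into two cliques. If G contains a clique C with |C| ≥ 2c (not necessarily maximal), then G contains an induced co-diamond, i.e., a 4-element vertex subset inducing exactly one edge. -/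
/-- In a `c`-closed graph, a vertex outside a maximal clique has fewer than `c` neighbours in it. -/
theorem SimpleGraph.ncard_neighborSet_inter_lt_of_maximal_isClique {V : Type*} [Finite V]
    {G : SimpleGraph V} {c : ℕ}
    (hclosed : ∀ u v : V, u ≠ v → ¬G.Adj u v →
      (G.neighborSet u ∩ G.neighborSet v).ncard < c)
    {M : Set V} (hM : Maximal G.IsClique M) {x : V} (hx : x ∉ M) :
    (G.neighborSet x ∩ M).ncard < c := by
  obtain ⟨w, hwM, hxw⟩ : ∃ w ∈ M, ¬G.Adj x w := by
    by_contra! h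
    have hins : G.IsClique (insert x M) :=
      SimpleGraph.isClique_insert.2 ⟨hM.prop, fun w hw _ => h w hw⟩
    exact hx (hM.le_of_ge hins (Set.subset_insert x M) (Set.mem_insert x M))
  have hne : x ≠ w := fun h => hx (h ▸ hwM)
  refine lt_of_le_of_lt (Set.ncard_le_ncard ?_ (Set.toFinite _)) (hclosed x w hne hxw)
  rintro z ⟨hxz, hzM⟩
  exact ⟨hxz, hM.prop hwM hzM fun h => hxw (h ▸ hxz)⟩

/-- If `G` is `c`-closed (`c ≥ 1`), its vertex set cannot be partitioned into two cliques,
and `G` contains a (not necessarily maximal) clique `C` with `|C| ≥ 2c`, then `G` contains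
an induced co-diamond (four vertices spanning exactly one edge). -/
theorem stmt_4 {V : Type*} [Fintype V] (G : SimpleGraph V) (c : ℕ) (hc : 1 ≤ c)
    (hclosed : ∀ u v : V, u ≠ v → ¬G.Adj u v →
      (G.neighborSet u ∩ G.neighborSet v).ncard < c)
    (hpart : ¬∃ C₁ C₂ : Set V, C₁ ∪ C₂ = Set.univ ∧ C₁ ∩ C₂ = ∅ ∧
      G.IsClique C₁ ∧ G.IsClique C₂)
    (C : Set V) (hC : G.IsClique C) (hcard : 2 * c ≤ C.ncard) :
    ∃ a b x y : V, a ≠ b ∧ a ≠ x ∧ a ≠ y ∧ b ≠ x ∧ b ≠ y ∧ x ≠ y ∧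
      G.Adj a b ∧ ¬G.Adj a x ∧ ¬G.Adj a y ∧ ¬G.Adj b x ∧ ¬G.Adj b y ∧ ¬G.Adj x y := by
  obtain ⟨M, hCM, hM⟩ := (Set.toFinite {s : Set V | G.IsClique s}).exists_le_maximal hC
  have hcardM : 2 * c ≤ M.ncard := hcard.trans (Set.ncard_le_ncard hCM (Set.toFinite _))
  have hcompl : ¬G.IsClique Mᶜ := fun h =>
    hpart ⟨M, Mᶜ, Set.union_compl_self M, Set.inter_compl_self M, hM.prop, h⟩
  obtain ⟨x, hx, y, hy, hxy, hadj⟩ : ∃ x ∈ Mᶜ, ∃ y ∈ Mᶜ, x ≠ y ∧ ¬G.Adj x y := by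
    by_contra! h
    exact hcompl fun x hx y hy hxy => h x hx y hy hxy
  have hNx := SimpleGraph.ncard_neighborSet_inter_lt_of_maximal_isClique hclosed hM hx
  have hNy := SimpleGraph.ncard_neighborSet_inter_lt_of_maximal_isClique hclosed hM hy
  set S := (G.neighborSet x ∩ M) ∪ (G.neighborSet y ∩ M)
  have hScard : S.ncard ≤ _ := Set.ncard_union_le _ _
  have hdiff := Set.le_ncard_sdiff S M (Set.toFinite _)
  obtain ⟨a, b, ha, hb, hab⟩ := (Set.one_lt_ncard_iff (Set.toFinite (M \ S))).1 (by omega)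
  have key : ∀ z ∈ M \ S, z ∈ M ∧ ¬G.Adj z x ∧ ¬G.Adj z y := fun z hz =>
    ⟨hz.1, fun h => hz.2 (.inl ⟨h.symm, hz.1⟩), fun h => hz.2 (.inr ⟨h.symm, hz.1⟩)⟩
  obtain ⟨haM, hax, hay⟩ := key a ha
  obtain ⟨hbM, hbx, hby⟩ := key b hb
  exact ⟨a, b, x, y, hab, fun h => hx (h ▸ haM), fun h => hy (h ▸ haM), fun h => hx (h ▸ hbM),
    fun h => hy (h ▸ hbM), hxy, hM.prop haM hbM hab, hax, hay, hbx, hby, hadj⟩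
end

section
/- Let G be a c-closed simple graph (c ≥ 1). Suppose there are non-adjacent vertices u, v ∈ V(G) with deg(u) ≥ c and deg(v) ≥ 2c − 1. Then G contains an induced co-square, i.e., a 4-element vertex subset inducing exactly two disjoint edges (2K2). -/
/-- If `G` is `c`-closed (`c ≥ 1`) and there are non-adjacent vertices `u, v` with
`deg(u) ≥ c` and `deg(v) ≥ 2c - 1`, then `G` contains an induced co-square
(four vertices spanning exactly two disjoint edges, `2K₂`). -/
theorem stmt_5 {V : Type*} [Fintype V] (G : SimpleGraph V) (c : ℕ) (hc : 1 ≤ c)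
    (hclosed : ∀ u v : V, u ≠ v → ¬G.Adj u v →
      (G.neighborSet u ∩ G.neighborSet v).ncard < c)
    (u v : V) (huv : u ≠ v) (hnadj : ¬G.Adj u v)
    (hdu : c ≤ (G.neighborSet u).ncard) (hdv : 2 * c - 1 ≤ (G.neighborSet v).ncard) :
    ∃ a b x y : V, a ≠ x ∧ a ≠ y ∧ b ≠ x ∧ b ≠ y ∧
      G.Adj a b ∧ G.Adj x y ∧ ¬G.Adj a x ∧ ¬G.Adj a y ∧ ¬G.Adj b x ∧ ¬G.Adj b y := by
  have huv_lt := hclosed u v huv hnadj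
  obtain ⟨a, hua, hva⟩ : ∃ a, G.Adj u a ∧ ¬G.Adj v a := by
    by_contra! h
    have hle : (G.neighborSet u).ncard ≤ (G.neighborSet u ∩ G.neighborSet v).ncard :=
      Set.ncard_le_ncard (fun w hw => ⟨hw, h w hw⟩) (Set.toFinite _)
    omega
  have hav : a ≠ v := by
    rintro rfl
    exact hnadj hua
  have hav_lt := hclosed a v hav (fun h => hva h.symm)
  obtain ⟨b, hvb, hub, hab⟩ : ∃ b, G.Adj v b ∧ ¬G.Adj u b ∧ ¬G.Adj a b := by
    by_contra! h
    have hsub : G.neighborSet v ⊆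
        (G.neighborSet u ∩ G.neighborSet v) ∪ (G.neighborSet a ∩ G.neighborSet v) := by
      intro w hw
      by_cases huw : G.Adj u w
      · exact Or.inl ⟨huw, hw⟩
      · exact Or.inr ⟨h w hw huw, hw⟩
    have hle := Set.ncard_le_ncard hsub (Set.toFinite _)
    have hunion := Set.ncard_union_le
      (G.neighborSet u ∩ G.neighborSet v) (G.neighborSet a ∩ G.neighborSet v)
    omega
  refine ⟨u, a, v, b, huv, ?_, hav, ?_, hua, hvb, hnadj, hub, fun h => hva h.symm, hab⟩
  · rintro rfl
    exact hnadj hvb.symm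
  · rintro rfl
    exact hva hvb
end

section
/- Let (P, L) be a finite projective plane with point set P and line set L. Define the graph G on vertex set (P × {1,2}) ⊔ (L × {1,2}) with the following edges: (u,1)(u,2) for each point u ∈ P; (v,1)(v,2) for each line v ∈ L; and (u,i)(v,j) for all i, j ∈ {1,2} whenever point u is incident with line v. Then G is 3-closed: every pair of distinct non-adjacent vertices of G has fewer than 3 common neighbors. -/
/-- A set all of whose elements are values of a function on `Fin 2` has fewer than three elements. -/
theorem Set.ncard_lt_three_of_subset_range {α : Type*} {s : Set α} (f : Fin 2 → α)
    (h : s ⊆ Set.range f) : s.ncard < 3 := by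
  have hcard : (Set.range f).ncard ≤ 2 := by
    rw [← Set.image_univ]
    simpa using Set.ncard_image_le (f := f) (Set.finite_univ (α := Fin 2))
  have := Set.ncard_le_ncard h (Set.finite_range f)
  omega

/-- Let `(P, L)` be a finite projective plane and let `G` be the graph on
`(P × Fin 2) ⊕ (L × Fin 2)` where the two copies of each point (resp. line) are adjacent,
and all copies of a point are adjacent to all copies of a line incident with it.
Then `G` is `3`-closed. -/
theorem stmt_6 {P L : Type*} [Fintype P] [Fintype L] [Membership P L]
    [Configuration.ProjectivePlane P L]
    (G : SimpleGraph ((P × Fin 2) ⊕ (L × Fin 2)))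
    (hG : ∀ x y : (P × Fin 2) ⊕ (L × Fin 2), G.Adj x y ↔ x ≠ y ∧
      (match x, y with
       | Sum.inl (u, _), Sum.inl (u', _) => u = u'
       | Sum.inr (v, _), Sum.inr (v', _) => v = v'
       | Sum.inl (u, _), Sum.inr (v, _) => u ∈ v
       | Sum.inr (v, _), Sum.inl (u, _) => u ∈ v)) :
    ∀ x y : (P × Fin 2) ⊕ (L × Fin 2), x ≠ y → ¬G.Adj x y →
      (G.neighborSet x ∩ G.neighborSet y).ncard < 3 := by
  rintro (⟨u, i⟩ | ⟨v, i⟩) (⟨u', j⟩ | ⟨v', j⟩) hne hadj <;> rw [hG] at hadj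
  · have hu : u ≠ u' := fun h => hadj ⟨hne, h⟩
    obtain ⟨h₁, h₂⟩ := Configuration.HasLines.mkLine_ax (L := L) hu
    refine Set.ncard_lt_three_of_subset_range
      (fun k => Sum.inr (Configuration.HasLines.mkLine hu, k)) ?_
    rintro (⟨w, k⟩ | ⟨w, k⟩) ⟨ha, hb⟩ <;> rw [SimpleGraph.mem_neighborSet, hG] at ha hb
    · exact absurd (ha.2.trans hb.2.symm) hu
    · have hw := (Configuration.Nondegenerate.eq_or_eq h₁ h₂ ha.2 hb.2).resolve_left hu
      exact ⟨k, by rw [hw]⟩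
  · have hu : u ∉ v' := fun h => hadj ⟨hne, h⟩
    refine Set.ncard_lt_three_of_subset_range (fun _ => Sum.inl (u, i)) ?_
    rintro (⟨w, k⟩ | ⟨w, k⟩) ⟨ha, hb⟩ <;> rw [SimpleGraph.mem_neighborSet, hG] at ha hb <;>
      obtain ⟨-, ha⟩ := ha <;> obtain ⟨-, hb⟩ := hb <;> dsimp only at ha hb <;> subst_vars <;>
      contradiction
  · have hu : u' ∉ v := fun h => hadj ⟨hne, h⟩
    refine Set.ncard_lt_three_of_subset_range (fun _ => Sum.inl (u', i)) ?_
    rintro (⟨w, k⟩ | ⟨w, k⟩) ⟨ha, hb⟩ <;> rw [SimpleGraph.mem_neighborSet, hG] at ha hb <;>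
      obtain ⟨-, ha⟩ := ha <;> obtain ⟨-, hb⟩ := hb <;> dsimp only at ha hb <;> subst_vars <;>
      contradiction
  · have hv : v ≠ v' := fun h => hadj ⟨hne, h⟩
    obtain ⟨h₁, h₂⟩ := Configuration.HasPoints.mkPoint_ax (P := P) hv
    refine Set.ncard_lt_three_of_subset_range
      (fun k => Sum.inl (Configuration.HasPoints.mkPoint hv, k)) ?_
    rintro (⟨w, k⟩ | ⟨w, k⟩) ⟨ha, hb⟩ <;> rw [SimpleGraph.mem_neighborSet, hG] at ha hb
    · have hw := (Configuration.Nondegenerate.eq_or_eq h₁ ha.2 h₂ hb.2).resolve_right hv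
      exact ⟨k, by rw [hw]⟩
    · exact absurd (ha.2.trans hb.2.symm) hv
end

section
/- Let (P, L) be a finite projective plane of order p with n' points (so n' = p² + p + 1). Let G be the graph on vertex set (P × {1,2}) ⊔ (L × {1,2}) with edges (u,1)(u,2) for each point u, (v,1)(v,2) for each line v, and (u,i)(v,j) for all i, j ∈ {1,2} whenever point u lies on line v. Then G contains at least p · n'(n'−1)/2 distinct 4-element vertex subsets inducing a path P4 on four vertices. (For distinct points u, u' with common line v and any line v' through u but not through u', the set {(u,1), (v,1), (u',1), (v',1)} induces a P4.) -/
/-- In a projective plane of order `p` on `n` points, there are `p n (n - 1)`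
triples of a line, a point on it and a point off it. -/
theorem card_line_point_on_point_off {P L : Type*} [Fintype P] [Fintype L] [Membership P L]
    [Configuration.ProjectivePlane P L] :
    Nat.card (Σ l : L, {u : P // u ∈ l} × {u : P // u ∉ l}) =
      Configuration.ProjectivePlane.order P L *
        (Fintype.card P * (Fintype.card P - 1)) := by
  classical
  have hP := Configuration.ProjectivePlane.card_points P L
  have hL := Configuration.ProjectivePlane.card_lines P L
  have hon (l : L) : Nat.card {u : P // u ∈ l} = Configuration.ProjectivePlane.order P L + 1 :=
    Configuration.ProjectivePlane.pointCount_eq P l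
  have hoff (l : L) : Nat.card {u : P // u ∉ l} = Configuration.ProjectivePlane.order P L ^ 2 := by
    have h := Fintype.card_subtype_compl (fun u : P => u ∈ l)
    have h' := hon l
    rw [Nat.card_eq_fintype_card] at h' ⊢
    rw [h, h', hP]
    omega
  rw [Nat.card_sigma]
  simp only [Nat.card_prod, hon, hoff, Finset.sum_const, Finset.card_univ, smul_eq_mul, hP, hL,
    Nat.add_sub_cancel]
  ring


/-- Let `(P, L)` be a finite projective plane of order `p` with `n' = p² + p + 1` points,
and let `G` be the graph on `(P × Fin 2) ⊕ (L × Fin 2)` where the two copies of each point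
(resp. line) are adjacent, and all copies of a point are adjacent to all copies of a line
incident with it. Then `G` contains at least `p · n'(n'-1)/2` distinct 4-element vertex
subsets inducing a path `P₄`. -/
theorem stmt_7 {P L : Type*} [Fintype P] [Fintype L] [DecidableEq P] [DecidableEq L]
    [Membership P L] [Configuration.ProjectivePlane P L]
    (p n' : ℕ) (horder : Configuration.ProjectivePlane.order P L = p)
    (hn' : Fintype.card P = n') (hn'eq : n' = p ^ 2 + p + 1)
    (G : SimpleGraph ((P × Fin 2) ⊕ (L × Fin 2)))
    (hG : ∀ x y : (P × Fin 2) ⊕ (L × Fin 2), G.Adj x y ↔ x ≠ y ∧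
      (match x, y with
       | Sum.inl (u, _), Sum.inl (u', _) => u = u'
       | Sum.inr (v, _), Sum.inr (v', _) => v = v'
       | Sum.inl (u, _), Sum.inr (v, _) => u ∈ v
       | Sum.inr (v, _), Sum.inl (u, _) => u ∈ v)) :
    p * (n' * (n' - 1) / 2) ≤
      {s : Finset ((P × Fin 2) ⊕ (L × Fin 2)) | s.card = 4 ∧
        ∃ a b c d, s = {a, b, c, d} ∧
          a ≠ b ∧ a ≠ c ∧ a ≠ d ∧ b ≠ c ∧ b ≠ d ∧ c ≠ d ∧
          G.Adj a b ∧ G.Adj b c ∧ G.Adj c d ∧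
          ¬G.Adj a c ∧ ¬G.Adj a d ∧ ¬G.Adj b d}.ncard := by
  classical
  have hline (x : Σ l : L, {u : P // u ∈ l} × {u : P // u ∉ l}) :
      ∃ v : L, x.2.1.1 ∈ v ∧ x.2.2.1 ∈ v :=
    ⟨Configuration.HasLines.mkLine (fun h : x.2.1.1 = x.2.2.1 => x.2.2.2 (h ▸ x.2.1.2)),
      Configuration.HasLines.mkLine_ax _⟩
  choose f hf hf' using hline
  let F (x : Σ l : L, {u : P // u ∈ l} × {u : P // u ∉ l}) :
      Finset ((P × Fin 2) ⊕ (L × Fin 2)) :=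
    {Sum.inl (x.2.2.1, 0), Sum.inr (f x, 0), Sum.inl (x.2.1.1, 0), Sum.inr (x.1, 0)}
  have hF_inj : Function.Injective F := by
    rintro ⟨l, ⟨u, hu⟩, ⟨w, hw⟩⟩ ⟨l', ⟨u', hu'⟩, ⟨w', hw'⟩⟩ h
    have hp (z : P) : z = w ∨ z = u ↔ z = w' ∨ z = u' := by
      simpa [F] using Finset.ext_iff.mp h (Sum.inl (z, 0))
    have hl (m : L) : m = f ⟨l, ⟨u, hu⟩, ⟨w, hw⟩⟩ ∨ m = l ↔
        m = f ⟨l', ⟨u', hu'⟩, ⟨w', hw'⟩⟩ ∨ m = l' := by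
      simpa [F] using Finset.ext_iff.mp h (Sum.inr (m, 0))
    have hf₁ := hf ⟨l', ⟨u', hu'⟩, ⟨w', hw'⟩⟩
    have hf₂ := hf' ⟨l', ⟨u', hu'⟩, ⟨w', hw'⟩⟩
    dsimp only at hf₁ hf₂
    have hll : l = l' := by
      rcases (hl l).mp (Or.inr rfl) with h₁ | h₁
      · rw [← h₁] at hf₁ hf₂
        rcases (hp w).mp (Or.inl rfl) with h₂ | h₂
        · exact absurd (h₂ ▸ hf₂) hw
        · exact absurd (h₂ ▸ hf₁) hw
      · exact h₁
    subst hll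
    have huu : u = u' := by
      rcases (hp u).mp (Or.inr rfl) with h₂ | h₂
      · exact absurd (h₂ ▸ hu) hw'
      · exact h₂
    have hww : w = w' := by
      rcases (hp w).mp (Or.inl rfl) with h₂ | h₂
      · exact h₂
      · exact absurd (h₂ ▸ hu') hw
    subst huu hww
    rfl
  have hF_range : Set.range F ⊆
      {s : Finset ((P × Fin 2) ⊕ (L × Fin 2)) | s.card = 4 ∧
        ∃ a b c d, s = {a, b, c, d} ∧
          a ≠ b ∧ a ≠ c ∧ a ≠ d ∧ b ≠ c ∧ b ≠ d ∧ c ≠ d ∧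
          G.Adj a b ∧ G.Adj b c ∧ G.Adj c d ∧
          ¬G.Adj a c ∧ ¬G.Adj a d ∧ ¬G.Adj b d} := by
    rintro _ ⟨⟨l, ⟨u, hu⟩, ⟨w, hw⟩⟩, rfl⟩
    have h₁ := hf ⟨l, ⟨u, hu⟩, ⟨w, hw⟩⟩
    have h₂ := hf' ⟨l, ⟨u, hu⟩, ⟨w, hw⟩⟩
    dsimp only at h₁ h₂
    have hwu : w ≠ u := fun h => hw (h ▸ hu)
    have hfl : f ⟨l, ⟨u, hu⟩, ⟨w, hw⟩⟩ ≠ l := fun h => hw (h ▸ h₂)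
    refine ⟨?_, _, _, _, _, rfl, ?_⟩
    · simp [F, hwu, hfl]
    · simp [hG, hwu, hfl, h₁, h₂, hu, hw]
  have hcard := Set.ncard_le_ncard hF_range (Set.toFinite _)
  rw [← Nat.card_coe_set_eq, Nat.card_range_of_injective hF_inj, card_line_point_on_point_off,
    horder, hn'] at hcard
  exact (Nat.mul_le_mul_left p (Nat.div_le_self _ 2)).trans hcard
end

section
/- Let G be a c-closed simple graph (c ≥ 1) on n vertices with n ≥ 6c, whose vertex set cannot be partitioned into two cliques. If G contains an edge uw with deg(u) ≤ 2c and deg(w) ≤ 2c, then G contains an induced co-diamond, i.e., a 4-element vertex subset inducing exactly one edge. -/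
/-- In a `c`-closed graph, a vertex missing some other vertex of a clique `K` has fewer than `c`
neighbours in `K`. -/
lemma SimpleGraph.IsClique.ncard_neighborSet_inter_lt {V : Type*} [Finite V] {G : SimpleGraph V}
    {c : ℕ} (hclosed : ∀ u v : V, u ≠ v → ¬G.Adj u v →
      (G.neighborSet u ∩ G.neighborSet v).ncard < c)
    {K : Set V} (hK : G.IsClique K) {a k : V} (hk : k ∈ K) (hka : k ≠ a) (hak : ¬G.Adj a k) :
    (G.neighborSet a ∩ K).ncard < c := by
  refine lt_of_le_of_lt (Set.ncard_le_ncard ?_ (Set.toFinite _)) (hclosed a k hka.symm hak)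
  rintro x ⟨hax, hxK⟩
  refine ⟨hax, hK hk hxK ?_⟩
  rintro rfl
  exact hak hax

/-- Let `G` be a `c`-closed graph (`c ≥ 1`) on `n ≥ 6c` vertices whose vertex set cannot be
partitioned into two cliques. If `G` has an edge `uw` with `deg(u) ≤ 2c` and `deg(w) ≤ 2c`,
then `G` contains an induced co-diamond (four vertices spanning exactly one edge). -/
theorem stmt_14 {V : Type*} [Fintype V] (G : SimpleGraph V) (c : ℕ) (hc : 1 ≤ c)
    (hn : 6 * c ≤ Fintype.card V)
    (hclosed : ∀ u v : V, u ≠ v → ¬G.Adj u v →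
      (G.neighborSet u ∩ G.neighborSet v).ncard < c)
    (hpart : ¬∃ C₁ C₂ : Set V, C₁ ∪ C₂ = Set.univ ∧ C₁ ∩ C₂ = ∅ ∧
      G.IsClique C₁ ∧ G.IsClique C₂)
    (u w : V) (huw : G.Adj u w)
    (hdu : (G.neighborSet u).ncard ≤ 2 * c) (hdw : (G.neighborSet w).ncard ≤ 2 * c) :
    ∃ a b x y : V, a ≠ b ∧ a ≠ x ∧ a ≠ y ∧ b ≠ x ∧ b ≠ y ∧ x ≠ y ∧
      G.Adj a b ∧ ¬G.Adj a x ∧ ¬G.Adj a y ∧ ¬G.Adj b x ∧ ¬G.Adj b y ∧ ¬G.Adj x y := by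
  by_contra hno
  set K : Set V := (G.neighborSet u ∪ G.neighborSet w)ᶜ with hKdef
  have hK : G.IsClique K := by
    intro x hx y hy hxy
    by_contra hadj
    simp only [hKdef, Set.mem_compl_iff, Set.mem_union, SimpleGraph.mem_neighborSet,
      not_or] at hx hy
    refine hno ⟨u, w, x, y, huw.ne, ?_, ?_, ?_, ?_, hxy, huw, hx.1, hy.1, hx.2, hy.2, hadj⟩
    · rintro rfl; exact hx.2 huw.symm
    · rintro rfl; exact hy.2 huw.symm
    · rintro rfl; exact hx.1 huw
    · rintro rfl; exact hy.1 huw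
  have hKcard : 2 * c ≤ K.ncard := by
    have h₁ := Set.ncard_add_ncard_compl (G.neighborSet u ∪ G.neighborSet w)
    have h₂ := Set.ncard_union_le (G.neighborSet u) (G.neighborSet w)
    rw [Nat.card_eq_fintype_card, ← hKdef] at h₁
    omega
  let B : Set V := {v | ∀ k ∈ K, k ≠ v → G.Adj v k}
  refine hpart ⟨B, Bᶜ, Set.union_compl_self B, Set.inter_compl_self B, ?_, ?_⟩
  · intro x hx y hy hxy
    by_contra hadj
    have hsub : K ⊆ G.neighborSet x ∩ G.neighborSet y := by
      intro k hk
      refine ⟨hx k hk ?_, hy k hk ?_⟩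
      · rintro rfl; exact hadj (hy k hk hxy).symm
      · rintro rfl; exact hadj (hx k hk hxy.symm)
    have h₁ := Set.ncard_le_ncard hsub (Set.toFinite _)
    have h₂ := hclosed x y hxy hadj
    omega
  · have hfew : ∀ a ∈ Bᶜ, a ∉ K ∧ (G.neighborSet a ∩ K).ncard < c := by
      intro a ha
      simp only [B, Set.mem_compl_iff, Set.mem_ofPred_eq, not_forall] at ha
      obtain ⟨k, hk, hka, hak⟩ := ha
      exact ⟨fun haK => hak (hK haK hk hka.symm),
        hK.ncard_neighborSet_inter_lt hclosed hk hka hak⟩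
    intro a ha b hb hab
    by_contra hadj
    obtain ⟨haK, ha'⟩ := hfew a ha
    obtain ⟨hbK, hb'⟩ := hfew b hb
    have hmiss : 1 < (K \ (G.neighborSet a ∩ K ∪ G.neighborSet b ∩ K)).ncard := by
      have h₁ := Set.ncard_union_le (G.neighborSet a ∩ K) (G.neighborSet b ∩ K)
      have h₂ := Set.le_ncard_sdiff (G.neighborSet a ∩ K ∪ G.neighborSet b ∩ K) K
        (Set.toFinite _)
      omega
    obtain ⟨k, l, ⟨hk, hk'⟩, ⟨hl, hl'⟩, hkl⟩ := (Set.one_lt_ncard_iff (Set.toFinite _)).1 hmiss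
    simp only [Set.mem_union, Set.mem_inter_iff, SimpleGraph.mem_neighborSet, hk, hl,
      and_true, not_or] at hk' hl'
    exact hno ⟨k, l, a, b, hkl, ne_of_mem_of_not_mem hk haK, ne_of_mem_of_not_mem hk hbK,
      ne_of_mem_of_not_mem hl haK, ne_of_mem_of_not_mem hl hbK, hab, hK hk hl hkl,
      fun h => hk'.1 h.symm, fun h => hk'.2 h.symm, fun h => hl'.1 h.symm,
      fun h => hl'.2 h.symm, hadj⟩
end

section
/- Let G be a c-closed simple graph (c ≥ 1) on n vertices whose vertex set cannot be partitioned into two cliques. If G contains a vertex v with 2c < deg(v) ≤ n − 2c − 1, then G contains an induced co-diamond, i.e., a 4-element vertex subset inducing exactly one edge. -/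
/-- Let `G` be a `c`-closed graph (`c ≥ 1`) on `n` vertices whose vertex set cannot be
partitioned into two cliques. If `G` has a vertex `v` with `2c < deg(v) ≤ n - 2c - 1`,
then `G` contains an induced co-diamond (four vertices spanning exactly one edge). -/
theorem stmt_15 {V : Type*} [Fintype V] (G : SimpleGraph V) (c : ℕ) (hc : 1 ≤ c)
    (hclosed : ∀ u v : V, u ≠ v → ¬G.Adj u v →
      (G.neighborSet u ∩ G.neighborSet v).ncard < c)
    (hpart : ¬∃ C₁ C₂ : Set V, C₁ ∪ C₂ = Set.univ ∧ C₁ ∩ C₂ = ∅ ∧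
      G.IsClique C₁ ∧ G.IsClique C₂)
    (v : V) (hdv₁ : 2 * c < (G.neighborSet v).ncard)
    (hdv₂ : (G.neighborSet v).ncard ≤ Fintype.card V - 2 * c - 1) :
    ∃ a b x y : V, a ≠ b ∧ a ≠ x ∧ a ≠ y ∧ b ≠ x ∧ b ≠ y ∧ x ≠ y ∧
      G.Adj a b ∧ ¬G.Adj a x ∧ ¬G.Adj a y ∧ ¬G.Adj b x ∧ ¬G.Adj b y ∧ ¬G.Adj x y := by
  by_contra hco
  have codiamondFree : ∀ a b x y : V, G.Adj a b → x ≠ y → ¬G.Adj x y → a ≠ x → a ≠ y → b ≠ x →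
      b ≠ y → G.Adj a x ∨ G.Adj a y ∨ G.Adj b x ∨ G.Adj b y := by
    intro a b x y hab hxy hnxy h1 h2 h3 h4
    by_contra! h
    exact hco ⟨a, b, x, y, hab.ne, h1, h2, h3, h4, hxy, hab, h.1, h.2.1, h.2.2.1, h.2.2.2, hnxy⟩
  set B : Set V := {u | u ≠ v ∧ ¬G.Adj v u} with hB
  have hBcard : 2 * c ≤ B.ncard := by
    have hcompl : Bᶜ = insert v (G.neighborSet v) := by
      ext u
      simp only [hB, Set.mem_compl_iff, Set.mem_ofPred_eq, Set.mem_insert_iff,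
        SimpleGraph.mem_neighborSet]
      tauto
    have h1 := Set.ncard_add_ncard_compl B
    have h2 := Set.ncard_insert_le v (G.neighborSet v)
    rw [hcompl, Nat.card_eq_fintype_card] at h1
    omega
  have hBclique : G.IsClique B := by
    intro x hx y hy hxy
    by_contra hn
    have hsub : G.neighborSet v ⊆
        (G.neighborSet v ∩ G.neighborSet x) ∪ (G.neighborSet v ∩ G.neighborSet y) := by
      intro a ha
      have hax : a ≠ x := by rintro rfl; exact hx.2 ha
      have hay : a ≠ y := by rintro rfl; exact hy.2 ha
      rcases codiamondFree v a x y ha hxy hn hx.1.symm hy.1.symm hax hay with h | h | h | h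
      · exact absurd h hx.2
      · exact absurd h hy.2
      · exact Or.inl ⟨ha, h.symm⟩
      · exact Or.inr ⟨ha, h.symm⟩
    have h1 := Set.ncard_le_ncard hsub
    have h2 := Set.ncard_union_le (G.neighborSet v ∩ G.neighborSet x)
      (G.neighborSet v ∩ G.neighborSet y)
    have h3 := hclosed v x hx.1.symm hx.2
    have h4 := hclosed v y hy.1.symm hy.2
    omega
  have few_neighbors : ∀ a b, b ∈ B → G.Adj v a → ¬G.Adj a b →
      (B ∩ G.neighborSet a).ncard < c := by
    intro a b hb ha hab
    have hne : a ≠ b := by rintro rfl; exact hb.2 ha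
    refine (Set.ncard_le_ncard ?_).trans_lt (hclosed a b hne hab)
    rintro w ⟨hw, haw⟩
    refine ⟨haw, hBclique hb hw ?_⟩
    rintro rfl
    exact hab haw
  set K : Set V := {a | G.Adj v a ∧ ∀ b ∈ B, G.Adj a b} with hK
  refine hpart ⟨B ∪ K, (B ∪ K)ᶜ, Set.union_compl_self _, Set.inter_compl_self _, ?_, ?_⟩
  · rintro x (hx | hx) y (hy | hy) hxy
    · exact hBclique hx hy hxy
    · exact (hy.2 x hx).symm
    · exact hx.2 y hy
    · by_contra hn
      have hsub : B ⊆ G.neighborSet x ∩ G.neighborSet y := fun b hb => ⟨hx.2 b hb, hy.2 b hb⟩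
      have h1 := Set.ncard_le_ncard hsub
      have h2 := hclosed x y hxy hn
      omega
  · have outside : ∀ x ∈ (B ∪ K)ᶜ, x ≠ v → G.Adj v x ∧ ∃ b ∈ B, ¬G.Adj x b := by
      intro x hx hxv
      rw [Set.mem_compl_iff, Set.mem_union, not_or] at hx
      have hvx : G.Adj v x := by
        by_contra h
        exact hx.1 ⟨hxv, h⟩
      refine ⟨hvx, ?_⟩
      by_contra! h
      exact hx.2 ⟨hvx, h⟩
    intro x hx y hy hxy
    by_cases hxv : x = v
    · subst hxv
      exact (outside y hy hxy.symm).1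
    by_cases hyv : y = v
    · subst hyv
      exact (outside x hx hxy).1.symm
    obtain ⟨hvx, b, hb, hxb⟩ := outside x hx hxv
    obtain ⟨hvy, b', hb', hyb'⟩ := outside y hy hyv
    by_contra hn
    have h1 := few_neighbors x b hb hvx hxb
    have h2 := few_neighbors y b' hb' hvy hyb'
    have h3 := Set.ncard_union_le (B ∩ G.neighborSet x) (B ∩ G.neighborSet y)
    have h4 := Set.le_ncard_sdiff ((B ∩ G.neighborSet x) ∪ (B ∩ G.neighborSet y)) B
    obtain ⟨p, q, hp, hq, hpq⟩ := (Set.one_lt_ncard_iff).1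
      (show 1 < (B \ ((B ∩ G.neighborSet x) ∪ (B ∩ G.neighborSet y))).ncard by omega)
    have nonadj : ∀ w ∈ B \ ((B ∩ G.neighborSet x) ∪ (B ∩ G.neighborSet y)),
        ¬G.Adj w x ∧ ¬G.Adj w y := fun w hw =>
      ⟨fun h => hw.2 (Or.inl ⟨hw.1, h.symm⟩), fun h => hw.2 (Or.inr ⟨hw.1, h.symm⟩)⟩
    have ne_of_adj : ∀ w ∈ B, ∀ a, G.Adj v a → w ≠ a := by
      rintro w hw _ ha rfl
      exact hw.2 ha
    rcases codiamondFree p q x y (hBclique hp.1 hq.1 hpq) hxy hn (ne_of_adj p hp.1 x hvx)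
      (ne_of_adj p hp.1 y hvy) (ne_of_adj q hq.1 x hvx) (ne_of_adj q hq.1 y hvy) with h | h | h | h
    · exact (nonadj p hp).1 h
    · exact (nonadj p hp).2 h
    · exact (nonadj q hq).1 h
    · exact (nonadj q hq).2 h
end

section
/- Let G be a c-closed simple graph (c ≥ 1), let C be a clique of G with |C| ≥ 2c, and suppose there is an edge vv' of G with v, v' ∉ C and deg(v) ≤ 2c − 2 and deg(v') ≤ 2c − 2. Then G contains an induced co-square, i.e., a 4-element vertex subset inducing exactly two disjoint edges (2K2); in particular there exist adjacent u, w ∈ C each non-adjacent to both v and v', and {u, w, v, v'} induces a co-square. -/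
/-- In a graph where distinct non-adjacent vertices have fewer than `c` common neighbours, a vertex
outside a clique `C` with fewer than `|C|` neighbours has fewer than `c` neighbours in `C`. -/
theorem SimpleGraph.IsClique.ncard_inter_neighborSet_lt {V : Type*} [Finite V] {G : SimpleGraph V}
    {c : ℕ}
    (hclosed : ∀ u v : V, u ≠ v → ¬G.Adj u v →
      (G.neighborSet u ∩ G.neighborSet v).ncard < c)
    {C : Set V} (hC : G.IsClique C) {v : V} (hv : v ∉ C)
    (hdeg : (G.neighborSet v).ncard < C.ncard) :
    (C ∩ G.neighborSet v).ncard < c := by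
  obtain ⟨x, hxC, hx⟩ := Set.exists_mem_notMem_of_ncard_lt_ncard hdeg
  have hvx : v ≠ x := fun h => hv (h ▸ hxC)
  refine (Set.ncard_le_ncard ?_).trans_lt (hclosed v x hvx hx)
  rintro y ⟨hyC, hy⟩
  exact ⟨hy, hC hxC hyC fun h => hx (h ▸ hy)⟩

/-- Let `G` be `c`-closed (`c ≥ 1`), let `C` be a clique with `|C| ≥ 2c`, and let `vv'` be an
edge with `v, v' ∉ C` and `deg(v), deg(v') ≤ 2c - 2`. Then there exist adjacent vertices
`u, w ∈ C` each non-adjacent to both `v` and `v'`; in particular `{u, w, v, v'}` induces a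
co-square (`2K₂`). -/
theorem stmt_16 {V : Type*} [Fintype V] (G : SimpleGraph V) (c : ℕ) (hc : 1 ≤ c)
    (hclosed : ∀ u v : V, u ≠ v → ¬G.Adj u v →
      (G.neighborSet u ∩ G.neighborSet v).ncard < c)
    (C : Set V) (hC : G.IsClique C) (hcard : 2 * c ≤ C.ncard)
    (v v' : V) (hv : v ∉ C) (hv' : v' ∉ C) (hvv' : G.Adj v v')
    (hdv : (G.neighborSet v).ncard ≤ 2 * c - 2)
    (hdv' : (G.neighborSet v').ncard ≤ 2 * c - 2) :
    ∃ u w : V, u ∈ C ∧ w ∈ C ∧ G.Adj u w ∧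
      ¬G.Adj u v ∧ ¬G.Adj u v' ∧ ¬G.Adj w v ∧ ¬G.Adj w v' ∧
      u ≠ v ∧ u ≠ v' ∧ w ≠ v ∧ w ≠ v' := by
  have h₁ := hC.ncard_inter_neighborSet_lt hclosed hv (by omega)
  have h₂ := hC.ncard_inter_neighborSet_lt hclosed hv' (by omega)
  have hunion := Set.ncard_union_le (C ∩ G.neighborSet v) (C ∩ G.neighborSet v')
  have hdiff := Set.le_ncard_sdiff (C ∩ G.neighborSet v ∪ C ∩ G.neighborSet v') C
  obtain ⟨u, w, ⟨hu, hu'⟩, ⟨hw, hw'⟩, huw⟩ := (Set.one_lt_ncard_iff).1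
    (show 1 < (C \ (C ∩ G.neighborSet v ∪ C ∩ G.neighborSet v')).ncard by omega)
  simp only [Set.mem_union, Set.mem_inter_iff, SimpleGraph.mem_neighborSet, hu, hw, true_and,
    not_or, G.adj_comm v, G.adj_comm v'] at hu' hw'
  exact ⟨u, w, hu, hw, hC hu hw huw, hu'.1, hu'.2, hw'.1, hw'.2, ne_of_mem_of_not_mem hu hv,
    ne_of_mem_of_not_mem hu hv', ne_of_mem_of_not_mem hw hv, ne_of_mem_of_not_mem hw hv'⟩
end
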